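/- arXiv:0810.3071 — 6 statements merged into one kernel-verified Lean document; each statement's English description precedes it below -/
import Mathlib

section
/- (a) For every u ∈ 𝖣(D) one has B(Du) = 0 if and only if Du = 0; hence the null space of the operator BD (with domain 𝖣(D), u ↦ B(Du)) equals the null space of D. (b) The closed subspaces M = closure{B(Du) : u ∈ 𝖣(D)} and N = {u ∈ 𝖣(D) : Du = 0} satisfy M ∩ N = {0} and M + N = H; that is, H splits topologically (in general non-orthogonally) as the direct sum of the closure of the range of BD and the null space of BD. -/
open scoped InnerProductSpace

section

variable {H : Type*} [NormedAddCommGroup H] [InnerProductSpace ℂ H]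

theorem orthogonal_closure_range_le_map_ker (dom : Submodule ℂ H) (D : dom →ₗ[ℂ] H)
    (hsa : ∀ v w : H, (∀ u : dom, ⟪D u, v⟫_ℂ = ⟪(u : H), w⟫_ℂ) →
      ∃ hv : v ∈ dom, D ⟨v, hv⟩ = w) :
    (LinearMap.range D).topologicalClosureᗮ ≤ (LinearMap.ker D).map dom.subtype := by
  intro v hv
  obtain ⟨hvd, h⟩ := hsa v 0 fun u => by
    rw [inner_zero_right]
    exact (Submodule.mem_orthogonal _ v).1 hv _
      (Submodule.le_topologicalClosure _ (LinearMap.mem_range_self D u))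
  exact ⟨⟨v, hvd⟩, h, rfl⟩

/-- Accretivity passes from a subspace to its closure. -/
theorem accretive_on_closure (K : Submodule ℂ H) (B : H →L[ℂ] H) (δ : ℝ)
    (hacc : ∀ x ∈ K, δ * ‖x‖ ^ 2 ≤ (⟪B x, x⟫_ℂ).re) :
    ∀ x ∈ K.topologicalClosure, δ * ‖x‖ ^ 2 ≤ (⟪B x, x⟫_ℂ).re := by
  have hclosed : IsClosed {x : H | δ * ‖x‖ ^ 2 ≤ (⟪B x, x⟫_ℂ).re} :=
    isClosed_le (by fun_prop) (Complex.continuous_re.comp (by fun_prop))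
  exact fun x hx => closure_minimal hacc hclosed hx

/-- If `B` is strictly accretive on `K`, then `‖B x‖` is controlled by `‖B x + n‖` for `x ∈ K`
and `n ⊥ K`, and this passes to the closure of `B K`. -/
theorem norm_le_norm_add_of_mem_closure_map (K : Submodule ℂ H) (B : H →L[ℂ] H) {δ : ℝ}
    (hδ : 0 < δ) (hacc : ∀ x ∈ K, δ * ‖x‖ ^ 2 ≤ (⟪B x, x⟫_ℂ).re) {m n : H}
    (hm : m ∈ (K.map (B : H →ₗ[ℂ] H)).topologicalClosure) (hn : n ∈ Kᗮ) :
    δ * ‖m‖ ≤ ‖B‖ * ‖m + n‖ := by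
  have hclosed : IsClosed {y : H | δ * ‖y‖ ≤ ‖B‖ * ‖y + n‖} :=
    isClosed_le (by fun_prop) (by fun_prop)
  refine closure_minimal ?_ hclosed hm
  rintro _ ⟨x, hx, rfl⟩
  have hbound : δ * ‖x‖ ^ 2 ≤ ‖B x + n‖ * ‖x‖ := by
    calc δ * ‖x‖ ^ 2 ≤ (⟪B x, x⟫_ℂ).re := hacc x hx
      _ = (⟪B x + n, x⟫_ℂ).re := by
        rw [inner_add_left, (Submodule.mem_orthogonal' K n).1 hn x hx, add_zero]
      _ ≤ ‖B x + n‖ * ‖x‖ := re_inner_le_norm (𝕜 := ℂ) _ _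
  have hx' : δ * ‖x‖ ≤ ‖B x + n‖ := by
    rcases (norm_nonneg x).eq_or_lt with h | h
    · simp [← h]
    · exact le_of_mul_le_mul_right (by linarith [sq ‖x‖]) h
  calc δ * ‖B x‖ ≤ δ * (‖B‖ * ‖x‖) := by gcongr; exact B.le_opNorm x
    _ = ‖B‖ * (δ * ‖x‖) := by ring
    _ ≤ ‖B‖ * ‖B x + n‖ := by gcongr

/-- A Lax–Milgram splitting: if `B` is strictly accretive on a complete subspace `R`, then
`B R` and `Rᗮ` span the whole space. -/
theorem map_sup_orthogonal_eq_top_of_accretive (R : Submodule ℂ H) [CompleteSpace R]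
    (B : H →L[ℂ] H) {δ : ℝ} (hδ : 0 < δ)
    (hacc : ∀ x ∈ R, δ * ‖x‖ ^ 2 ≤ (⟪B x, x⟫_ℂ).re) :
    R.map (B : H →ₗ[ℂ] H) ⊔ Rᗮ = ⊤ := by
  set T : R →L[ℂ] R := R.orthogonalProjectionOnto ∘L B ∘L R.subtypeL
  have hT : IsUnit T := by
    refine T.isUnit_of_forall_le_norm_inner_map (c := ⟨δ, hδ.le⟩) hδ fun x => ?_
    have hinner : ⟪T x, x⟫_ℂ = ⟪B x, (x : H)⟫_ℂ :=
      Submodule.inner_orthogonalProjectionOnto_eq_of_mem_right x (B x)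
    rw [hinner, mul_comm]
    exact (hacc x x.2).trans (Complex.re_le_norm _)
  rw [Submodule.eq_top_iff']
  intro h
  obtain ⟨y, hy⟩ := (ContinuousLinearMap.isUnit_iff_bijective.1 hT).2 (R.orthogonalProjectionOnto h)
  refine Submodule.mem_sup.2 ⟨B y, ⟨y, y.2, rfl⟩, h - B y, ?_, add_sub_cancel _ _⟩
  rw [← Submodule.orthogonalProjectionOnto_eq_zero_iff, map_sub, ← hy]
  exact sub_self _

end

/-- Let `D` be a densely defined self-adjoint operator in a complex Hilbert
space `H` and let `B` be bounded and strictly accretive on the range of `D`. Then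
(a) `B(Du) = 0 ↔ Du = 0` for `u ∈ 𝖣(D)` (so the null space of `BD` equals that of `D`), and
(b) the closure `M` of the range of `BD` and the null space `N = N(D)` of `BD` satisfy
`M ∩ N = {0}` and `M + N = H`: a topological (in general non-orthogonal) splitting. -/
theorem null_space_and_splitting_of_BD
    {H : Type*} [NormedAddCommGroup H] [InnerProductSpace ℂ H] [CompleteSpace H]
    (dom : Submodule ℂ H) (D : dom →ₗ[ℂ] H)
    (hdense : Dense (dom : Set H))
    (hsym : ∀ u v : dom, ⟪D u, (v : H)⟫_ℂ = ⟪(u : H), D v⟫_ℂ)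
    (hsa : ∀ v w : H, (∀ u : dom, ⟪D u, v⟫_ℂ = ⟪(u : H), w⟫_ℂ) →
      ∃ hv : v ∈ dom, D ⟨v, hv⟩ = w)
    (B : H →L[ℂ] H) (δ : ℝ) (hδ : 0 < δ)
    (hacc : ∀ u : dom, δ * ‖D u‖ ^ 2 ≤ (⟪B (D u), D u⟫_ℂ).re) :
    (∀ u : dom, B (D u) = 0 ↔ D u = 0) ∧
    ((LinearMap.range ((B : H →ₗ[ℂ] H).comp D)).topologicalClosure ⊓
        (LinearMap.ker D).map dom.subtype = ⊥) ∧
    ((LinearMap.range ((B : H →ₗ[ℂ] H).comp D)).topologicalClosure ⊔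
        (LinearMap.ker D).map dom.subtype = ⊤) := by
  set K := LinearMap.range D
  have haccK : ∀ x ∈ K, δ * ‖x‖ ^ 2 ≤ (⟪B x, x⟫_ℂ).re := by
    rintro _ ⟨u, rfl⟩
    exact hacc u
  rw [LinearMap.range_comp]
  refine ⟨fun u => ⟨fun h => ?_, fun h => by rw [h, map_zero]⟩, ?_, ?_⟩
  · have hu := hacc u
    rw [h, inner_zero_left, Complex.zero_re] at hu
    have hsq : ‖D u‖ ^ 2 ≤ 0 := nonpos_of_mul_nonpos_right hu hδ
    simpa using le_antisymm hsq (sq_nonneg _)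
  · rw [Submodule.eq_bot_iff]
    rintro _ ⟨hM, ⟨u, hu, rfl⟩⟩
    have horth : -(u : H) ∈ Kᗮ := by
      refine neg_mem ((Submodule.mem_orthogonal _ _).2 ?_)
      rintro _ ⟨v, rfl⟩
      rw [hsym v u, LinearMap.mem_ker.1 hu, inner_zero_right]
    have h := norm_le_norm_add_of_mem_closure_map K B hδ haccK hM horth
    rw [Submodule.subtype_apply, add_neg_cancel, norm_zero, mul_zero] at h
    exact norm_le_zero_iff.1 (nonpos_of_mul_nonpos_right h hδ)
  · rw [eq_top_iff, ← map_sup_orthogonal_eq_top_of_accretive K.topologicalClosure B hδ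
      (accretive_on_closure K B δ haccK)]
    exact sup_le_sup (Submodule.topologicalClosure_map B K)
      (orthogonal_closure_range_le_map_ker dom D hsa)
end

section
/- There is a constant C, depending only on n, m, N and C_N, such that for every t > 0 and every smooth compactly supported g : ℝⁿ → ℂᵐ, Σ_{Q∈Δ_t} ‖Σ_{j≥0} Θ(1_{C_j(Q)}(g − g_Q))‖²_{L²(Q)} ≤ C t² ‖∇g‖²_{L²}, where g_Q = (1/|Q|)∫_Q g and each inner series converges in L²(Q). (This is the key estimate in the principal part approximation of Θ by γ_t S_t.) -/
open MeasureTheory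
open scoped ENNReal NNReal

noncomputable section

abbrev Edom (n : ℕ) := EuclideanSpace ℝ (Fin n)
abbrev Erng (m : ℕ) := EuclideanSpace ℂ (Fin m)
abbrev HS (n m : ℕ) := MeasureTheory.Lp (E := Erng m) 2 (volume : Measure (Edom n))

/-- The dyadic cube `2^j (z + (0,1]^n)`. -/
def dyCube (n : ℕ) (j : ℤ) (z : Fin n → ℤ) : Set (Edom n) :=
  {x | ∀ i, x i ∈ Set.Ioc ((2 : ℝ) ^ j * z i) ((2 : ℝ) ^ j * (z i + 1))}

/-- The cube `cQ` with the same center as the dyadic cube `Q = 2^j(z+(0,1]^n)` and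
sidelength `c · 2^j`. -/
def cCube (n : ℕ) (j : ℤ) (z : Fin n → ℤ) (c : ℝ) : Set (Edom n) :=
  {x | ∀ i, |x i - (2 : ℝ) ^ j * (z i + 1 / 2)| ≤ c * (2 : ℝ) ^ j / 2}

/-- `C_0(Q) = 2Q` and `C_i(Q) = 2^{i+1} Q \ 2^i Q` for `i ≥ 1`. -/
def annulus (n : ℕ) (j : ℤ) (z : Fin n → ℤ) : ℕ → Set (Edom n)
  | 0 => cCube n j z 2
  | i + 1 => cCube n j z (2 ^ (i + 2)) \ cCube n j z (2 ^ (i + 1))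

/-- Distance between two sets in a metric space. -/
def setDist {X : Type*} [PseudoMetricSpace X] (E F : Set X) : ℝ :=
  sInf (Set.image2 dist E F)

/-- The average of `g` over the dyadic cube `Q = 2^j(z+(0,1]^n)`. -/
def cubeAvg {n m : ℕ} (j : ℤ) (z : Fin n → ℤ) (g : Edom n → Erng m) : Erng m :=
  (volume (dyCube n j z)).toReal⁻¹ • ∫ y in dyCube n j z, g y

/-- Cauchy–Schwarz against the constant function, on an arbitrary measure space. -/
theorem sq_lintegral_le {α : Type*} [MeasurableSpace α] (μ : Measure α) {f : α → ℝ≥0∞}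
    (hf : AEMeasurable f μ) : (∫⁻ x, f x ∂μ) ^ 2 ≤ μ Set.univ * ∫⁻ x, f x ^ 2 ∂μ := by
  have h := ENNReal.lintegral_mul_le_Lp_mul_Lq μ Real.HolderConjugate.two_two hf
    (aemeasurable_const (b := (1 : ℝ≥0∞)))
  have h2 := pow_le_pow_left₀ zero_le h 2
  have hs (a : ℝ≥0∞) : (a ^ (1 / 2 : ℝ)) ^ 2 = a := by
    rw [← ENNReal.rpow_natCast, ← ENNReal.rpow_mul]; norm_num
  simp only [Pi.mul_apply, mul_one, mul_pow, hs, lintegral_const, one_pow, one_mul,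
    ENNReal.rpow_two] at h2
  rwa [mul_comm]

/-- Weighted Cauchy–Schwarz inequality for series in `ℝ≥0∞`. -/
theorem sq_tsum_mul_le (a b : ℕ → ℝ≥0∞) :
    (∑' i, a i * b i) ^ 2 ≤ (∑' i, a i) * ∑' i, a i * b i ^ 2 := by
  have h := sq_lintegral_le (Measure.sum fun i => a i • Measure.dirac i) (f := b)
    (measurable_of_countable b).aemeasurable
  simpa [lintegral_sum_measure, lintegral_smul_measure, Measure.sum_apply] using h

theorem sq_sum_le_card_mul {n : ℕ} (f : Fin n → ℝ≥0∞) :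
    (∑ i, f i) ^ 2 ≤ n * ∑ i, f i ^ 2 := by
  have h := sq_lintegral_le Measure.count (f := f) (measurable_of_countable f).aemeasurable
  simpa [lintegral_count, tsum_fintype, Measure.count_univ] using h

theorem volume_box {n : ℕ} (S : Fin n → Set ℝ) (hS : ∀ i, MeasurableSet (S i)) :
    volume {x : Edom n | ∀ i, x i ∈ S i} = ∏ i, volume (S i) := by
  have h := (EuclideanSpace.volume_preserving_symm_measurableEquiv_toLp (Fin n)).measure_preimage
    (MeasurableSet.univ_pi hS).nullMeasurableSet
  rw [← volume_pi_pi, ← h]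
  congr 1
  ext x
  simp

theorem volume_dyCube (n : ℕ) (j : ℤ) (z : Fin n → ℤ) :
    volume (dyCube n j z) = ENNReal.ofReal ((2 : ℝ) ^ j) ^ n := by
  unfold dyCube
  rw [volume_box (fun i => Set.Ioc ((2 : ℝ) ^ j * z i) ((2 : ℝ) ^ j * (z i + 1)))
    fun i => measurableSet_Ioc]
  simp only [Real.volume_Ioc]
  rw [Finset.prod_congr rfl fun i _ => by
    rw [show (2 : ℝ) ^ j * (z i + 1) - (2 : ℝ) ^ j * z i = (2 : ℝ) ^ j by ring]]
  simp

theorem measurableSet_dyCube (n : ℕ) (j : ℤ) (z : Fin n → ℤ) : MeasurableSet (dyCube n j z) := by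
  rw [dyCube, Set.ofPred_forall]
  refine MeasurableSet.iInter fun i => ?_
  exact measurableSet_Ioc.preimage (f := fun x : Edom n => x i) (by fun_prop)

theorem isClosed_cCube (n : ℕ) (j : ℤ) (z : Fin n → ℤ) (c : ℝ) : IsClosed (cCube n j z c) := by
  rw [cCube, Set.ofPred_forall]
  exact isClosed_iInter fun i => isClosed_le (by fun_prop) (by fun_prop)

theorem dyCube_subset_cCube (n : ℕ) (j : ℤ) (z : Fin n → ℤ) {c : ℝ} (hc : 1 ≤ c) :
    dyCube n j z ⊆ cCube n j z c := by
  intro x hx i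
  have h := hx i
  have hl : (0 : ℝ) < 2 ^ j := by positivity
  have h1 : (2 : ℝ) ^ j ≤ c * 2 ^ j := by nlinarith
  rw [abs_le]
  constructor <;> nlinarith [h.1, h.2]

theorem pairwise_disjoint_dyCube (n : ℕ) (j : ℤ) :
    Pairwise (Function.onFun Disjoint (dyCube n j)) := by
  intro z w hzw
  rw [Function.onFun, Set.disjoint_left]
  intro x hz hw
  apply hzw
  ext i
  have hl : (0 : ℝ) < 2 ^ j := by positivity
  have h1 : (z i : ℝ) < w i + 1 := lt_of_mul_lt_mul_left ((hz i).1.trans_le (hw i).2) hl.le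
  have h2 : (w i : ℝ) < z i + 1 := lt_of_mul_lt_mul_left ((hw i).1.trans_le (hz i).2) hl.le
  have h3 : z i < w i + 1 := by exact_mod_cast h1
  have h4 : w i < z i + 1 := by exact_mod_cast h2
  omega

/-- The squared `L²` norm of the gradient. -/
def gradEnergy {n m : ℕ} (g : Edom n → Erng m) : ℝ≥0∞ :=
  ∑ i : Fin n, ∫⁻ x, ‖fderiv ℝ g x (EuclideanSpace.single i (1 : ℝ))‖ₑ ^ 2

theorem gradEnergy_ne_top {n m : ℕ} {g : Edom n → Erng m} (hg : ContDiff ℝ 1 g)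
    (hc : HasCompactSupport g) : gradEnergy g ≠ ⊤ := by
  refine ENNReal.sum_ne_top.2 fun i _ => ?_
  have h1 : Continuous fun x => fderiv ℝ g x (EuclideanSpace.single i (1 : ℝ)) :=
    (hg.continuous_fderiv one_ne_zero).clm_apply continuous_const
  have h2 : HasCompactSupport fun x => fderiv ℝ g x (EuclideanSpace.single i (1 : ℝ)) :=
    hc.fderiv_apply (𝕜 := ℝ) _
  have h3 := h1.memLp_of_hasCompactSupport (p := 2) (μ := volume) h2
  have h4 := lintegral_rpow_enorm_lt_top_of_eLpNorm_lt_top two_ne_zero ENNReal.ofNat_ne_top h3.2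
  simpa using h4.ne

theorem enorm_clm_sq_le {n m : ℕ} (A : Edom n →L[ℝ] Erng m) (h : Edom n) {R : ℝ≥0∞}
    (hR : ∀ i, ‖h i‖ₑ ≤ R) :
    ‖A h‖ₑ ^ 2 ≤ n * R ^ 2 * ∑ i, ‖A (EuclideanSpace.single i (1 : ℝ))‖ₑ ^ 2 := by
  have h1 : A h = ∑ i, h i • A (EuclideanSpace.single i (1 : ℝ)) := by
    conv_lhs => rw [← (EuclideanSpace.basisFun (Fin n) ℝ).sum_repr h]
    simp
  have h2 : ‖A h‖ₑ ≤ R * ∑ i, ‖A (EuclideanSpace.single i (1 : ℝ))‖ₑ := by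
    rw [h1, Finset.mul_sum]
    refine (enorm_sum_le _ _).trans (Finset.sum_le_sum fun i _ => ?_)
    rw [enorm_smul]
    gcongr
    exact hR i
  calc ‖A h‖ₑ ^ 2 ≤ (R * ∑ i, ‖A (EuclideanSpace.single i (1 : ℝ))‖ₑ) ^ 2 := by gcongr
    _ = R ^ 2 * (∑ i, ‖A (EuclideanSpace.single i (1 : ℝ))‖ₑ) ^ 2 := mul_pow _ _ _
    _ ≤ R ^ 2 * (n * ∑ i, ‖A (EuclideanSpace.single i (1 : ℝ))‖ₑ ^ 2) := by
      gcongr; exact sq_sum_le_card_mul _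
    _ = _ := by ring

/-- Translations are Lipschitz in `L²` with constant controlled by the gradient. -/
theorem lintegral_sub_translate_sq_le {n m : ℕ} {g : Edom n → Erng m} (hg : ContDiff ℝ 1 g)
    (h : Edom n) {R : ℝ≥0∞} (hR : ∀ i, ‖h i‖ₑ ≤ R) :
    ∫⁻ y, ‖g (y + h) - g y‖ₑ ^ 2 ≤ n * R ^ 2 * gradEnergy g := by
  have hD : Continuous (fderiv ℝ g) := hg.continuous_fderiv one_ne_zero
  have hline (y : Edom n) :
      ‖g (y + h) - g y‖ₑ ^ 2 ≤ ∫⁻ s in Set.Ioc (0 : ℝ) 1, ‖fderiv ℝ g (y + s • h) h‖ₑ ^ 2 := by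
    have hd (s : ℝ) : HasDerivAt (fun s : ℝ => g (y + s • h)) (fderiv ℝ g (y + s • h) h) s := by
      have h1 : HasDerivAt (fun s : ℝ => y + s • h) h s := by
        simpa using ((hasDerivAt_id s).smul_const h).const_add y
      exact (hg.differentiable one_ne_zero _).hasFDerivAt.comp_hasDerivAt s h1
    have hcont : Continuous fun s : ℝ => fderiv ℝ g (y + s • h) h := by fun_prop
    have hFTC := intervalIntegral.integral_eq_sub_of_hasDerivAt (a := 0) (b := 1)
      (fun s _ => hd s) (hcont.intervalIntegrable _ _)
    rw [intervalIntegral.integral_of_le zero_le_one] at hFTC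
    simp only [one_smul, zero_smul, add_zero] at hFTC
    rw [← hFTC]
    calc _ ≤ (∫⁻ s in Set.Ioc (0 : ℝ) 1, ‖fderiv ℝ g (y + s • h) h‖ₑ) ^ 2 := by
          gcongr; exact enorm_integral_le_lintegral_enorm _
      _ ≤ _ := sq_lintegral_le _ hcont.enorm.measurable.aemeasurable
      _ = _ := by simp
  calc ∫⁻ y, ‖g (y + h) - g y‖ₑ ^ 2
      ≤ ∫⁻ y, ∫⁻ s in Set.Ioc (0 : ℝ) 1, ‖fderiv ℝ g (y + s • h) h‖ₑ ^ 2 := lintegral_mono hline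
    _ = ∫⁻ s in Set.Ioc (0 : ℝ) 1, ∫⁻ y, ‖fderiv ℝ g (y + s • h) h‖ₑ ^ 2 := by
      refine lintegral_lintegral_swap (Measurable.aemeasurable ?_)
      have : Continuous fun p : Edom n × ℝ => fderiv ℝ g (p.1 + p.2 • h) h := by fun_prop
      exact this.enorm.measurable.pow_const 2
    _ = ∫⁻ s in Set.Ioc (0 : ℝ) 1, ∫⁻ y, ‖fderiv ℝ g y h‖ₑ ^ 2 := by
      refine lintegral_congr fun s => ?_
      exact lintegral_add_right_eq_self (fun y => ‖fderiv ℝ g y h‖ₑ ^ 2) (s • h)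
    _ = ∫⁻ y, ‖fderiv ℝ g y h‖ₑ ^ 2 := by simp
    _ ≤ ∫⁻ y, n * R ^ 2 * ∑ i, ‖fderiv ℝ g y (EuclideanSpace.single i (1 : ℝ))‖ₑ ^ 2 :=
      lintegral_mono fun y => enorm_clm_sq_le _ _ hR
    _ = n * R ^ 2 * gradEnergy g := by
      have hm (i : Fin n) :
          Measurable fun y => ‖fderiv ℝ g y (EuclideanSpace.single i (1 : ℝ))‖ₑ ^ 2 := by
        have : Continuous fun y => fderiv ℝ g y (EuclideanSpace.single i (1 : ℝ)) := by fun_prop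
        exact this.enorm.measurable.pow_const 2
      rw [lintegral_const_mul _ (Finset.measurable_sum _ fun i _ => hm i),
        lintegral_finsetSum _ fun i _ => hm i, gradEnergy]

theorem enorm_sub_cubeAvg_sq_le {n m : ℕ} {g : Edom n → Erng m} (hg : Continuous g)
    (hc : HasCompactSupport g) (j : ℤ) (z : Fin n → ℤ) (x : Edom n) :
    ‖g x - cubeAvg j z g‖ₑ ^ 2
      ≤ (ENNReal.ofReal ((2 : ℝ) ^ j) ^ n)⁻¹ * ∫⁻ y in dyCube n j z, ‖g x - g y‖ₑ ^ 2 := by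
  have hl : (0 : ℝ) < 2 ^ j := by positivity
  have hv := volume_dyCube n j z
  set V := volume (dyCube n j z) with hV
  have hV0 : V ≠ 0 := by rw [hv]; positivity
  have hVt : V ≠ ⊤ := by rw [hv]; finiteness
  have hr0 : V.toReal ≠ 0 := ENNReal.toReal_ne_zero.2 ⟨hV0, hVt⟩
  have hfin : IsFiniteMeasure (volume.restrict (dyCube n j z)) :=
    ⟨by rw [Measure.restrict_apply_univ]; exact hVt.lt_top⟩
  have havg : g x - cubeAvg j z g = V.toReal⁻¹ • ∫ y in dyCube n j z, (g x - g y) := by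
    rw [integral_sub (integrable_const _) (hg.integrable_of_hasCompactSupport hc).integrableOn,
      smul_sub, cubeAvg, setIntegral_const, Measure.real, smul_smul, ← hV, inv_mul_cancel₀ hr0,
      one_smul]
  have he : ‖V.toReal⁻¹‖ₑ = V⁻¹ := by
    rw [Real.enorm_eq_ofReal (by positivity), ENNReal.ofReal_inv_of_pos (by positivity),
      ENNReal.ofReal_toReal hVt]
  rw [← hv, havg, enorm_smul, he, mul_pow]
  calc V⁻¹ ^ 2 * ‖∫ y in dyCube n j z, (g x - g y)‖ₑ ^ 2
      ≤ V⁻¹ ^ 2 * (∫⁻ y in dyCube n j z, ‖g x - g y‖ₑ) ^ 2 := by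
        gcongr; exact enorm_integral_le_lintegral_enorm _
    _ ≤ V⁻¹ ^ 2 * (V * ∫⁻ y in dyCube n j z, ‖g x - g y‖ₑ ^ 2) := by
        gcongr
        have := sq_lintegral_le (volume.restrict (dyCube n j z)) (f := fun y => ‖g x - g y‖ₑ)
          (by fun_prop)
        rwa [Measure.restrict_apply_univ] at this
    _ = V⁻¹ * (V⁻¹ * V) * ∫⁻ y in dyCube n j z, ‖g x - g y‖ₑ ^ 2 := by ring
    _ = _ := by rw [ENNReal.inv_mul_cancel hV0 hVt, mul_one]

/-- Summed Poincaré inequality over dilates of the dyadic cubes of a fixed generation. -/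
theorem tsum_lintegral_sub_cubeAvg_sq_le {n m : ℕ} {g : Edom n → Erng m} (hg : ContDiff ℝ 1 g)
    (hc : HasCompactSupport g) (j : ℤ) {c : ℝ} (h1c : 1 ≤ c) :
    ∑' z : Fin n → ℤ, ∫⁻ x in cCube n j z c, ‖g x - cubeAvg j z g‖ₑ ^ 2
      ≤ ENNReal.ofReal (2 ^ n * n * c ^ (n + 2) * ((2 : ℝ) ^ j) ^ 2) * gradEnergy g := by
  have hl : (0 : ℝ) < 2 ^ j := by positivity
  set l : ℝ := 2 ^ j with hl_def
  set R : ℝ := c * l with hR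
  have hR0 : 0 ≤ R := by positivity
  have hgc : Continuous g := hg.continuous
  set B : Set (Edom n) := {x | ∀ i, x i ∈ Set.Icc (-R) R} with hB
  have hBm : MeasurableSet B := by
    rw [hB, Set.ofPred_forall]
    exact MeasurableSet.iInter fun i =>
      measurableSet_Icc.preimage (f := fun x : Edom n => x i) (by fun_prop)
  have hBv : volume B = ENNReal.ofReal (2 * R) ^ n := by
    rw [hB, volume_box (fun _ => Set.Icc (-R) R) fun _ => measurableSet_Icc]
    simp [Real.volume_Icc, two_mul]
  set φ : Edom n → Edom n → ℝ≥0∞ := fun x y => ‖g x - g y‖ₑ ^ 2 with hφ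
  have hφm : Measurable (Function.uncurry φ) := by
    have : Continuous fun p : Edom n × Edom n => g p.1 - g p.2 := by fun_prop
    exact this.enorm.measurable.pow_const 2
  have hinner (z : Fin n → ℤ) (y : Edom n) (hy : y ∈ dyCube n j z) :
      ∫⁻ x in cCube n j z c, φ x y ≤ ∫⁻ h in B, φ (y + h) y := by
    rw [← lintegral_indicator (isClosed_cCube n j z c).measurableSet, ← lintegral_indicator hBm,
      ← lintegral_add_left_eq_self _ y]
    refine lintegral_mono fun h => ?_
    by_cases hx : y + h ∈ cCube n j z c
    · have hh : h ∈ B := by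
        intro i
        have h1 := abs_le.1 (hx i)
        have h2 := abs_le.1 (dyCube_subset_cCube n j z h1c hy i)
        simp only [PiLp.add_apply] at h1
        constructor <;> linarith [h1.1, h1.2, h2.1, h2.2]
      rw [Set.indicator_of_mem hx, Set.indicator_of_mem hh]
    · rw [Set.indicator_of_notMem hx]
      exact zero_le
  calc ∑' z : Fin n → ℤ, ∫⁻ x in cCube n j z c, ‖g x - cubeAvg j z g‖ₑ ^ 2
      ≤ ∑' z : Fin n → ℤ, (ENNReal.ofReal l ^ n)⁻¹ *
          ∫⁻ y in dyCube n j z, ∫⁻ h in B, φ (y + h) y := by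
        refine ENNReal.tsum_le_tsum fun z => ?_
        calc _ ≤ ∫⁻ x in cCube n j z c, (ENNReal.ofReal l ^ n)⁻¹ * ∫⁻ y in dyCube n j z, φ x y :=
              lintegral_mono fun x => enorm_sub_cubeAvg_sq_le hgc hc j z x
          _ = (ENNReal.ofReal l ^ n)⁻¹ * ∫⁻ x in cCube n j z c, ∫⁻ y in dyCube n j z, φ x y :=
              lintegral_const_mul _ hφm.lintegral_prod_right'
          _ = (ENNReal.ofReal l ^ n)⁻¹ * ∫⁻ y in dyCube n j z, ∫⁻ x in cCube n j z c, φ x y := by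
              rw [lintegral_lintegral_swap hφm.aemeasurable]
          _ ≤ _ := by
              gcongr 1
              exact setLIntegral_mono' (measurableSet_dyCube n j z) fun y hy => hinner z y hy
    _ = (ENNReal.ofReal l ^ n)⁻¹ * ∫⁻ y in ⋃ z, dyCube n j z, ∫⁻ h in B, φ (y + h) y := by
        rw [ENNReal.tsum_mul_left, lintegral_iUnion (measurableSet_dyCube n j)
          (pairwise_disjoint_dyCube n j)]
    _ ≤ (ENNReal.ofReal l ^ n)⁻¹ * ∫⁻ y, ∫⁻ h in B, φ (y + h) y := by
        gcongr 1; exact setLIntegral_le_lintegral _ _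
    _ = (ENNReal.ofReal l ^ n)⁻¹ * ∫⁻ h in B, ∫⁻ y, φ (y + h) y := by
        rw [lintegral_lintegral_swap]
        have : Continuous fun p : Edom n × Edom n => g (p.1 + p.2) - g p.1 := by fun_prop
        exact (this.enorm.measurable.pow_const 2).aemeasurable
    _ ≤ (ENNReal.ofReal l ^ n)⁻¹ * ∫⁻ h in B, n * ENNReal.ofReal R ^ 2 * gradEnergy g := by
        gcongr 1
        refine setLIntegral_mono' hBm fun h hh => lintegral_sub_translate_sq_le hg h fun i => ?_
        rw [Real.enorm_eq_ofReal_abs]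
        exact ENNReal.ofReal_le_ofReal (abs_le.2 (hh i))
    _ = _ := by
        rw [setLIntegral_const, hBv, ← ENNReal.ofReal_pow hl.le,
          ← ENNReal.ofReal_pow hR0, ← ENNReal.ofReal_pow (mul_nonneg zero_le_two hR0),
          ← ENNReal.ofReal_inv_of_pos (by positivity), ← ENNReal.ofReal_natCast n,
          ← ENNReal.ofReal_mul (by positivity), mul_right_comm, ← mul_assoc,
          ← ENNReal.ofReal_mul (by positivity), ← ENNReal.ofReal_mul (by positivity)]
        congr 2
        rw [hR]
        field_simp
        ring

theorem annulus_subset_cCube (n : ℕ) (j : ℤ) (z : Fin n → ℤ) (i : ℕ) :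
    annulus n j z i ⊆ cCube n j z (2 ^ (i + 1)) := by
  cases i with
  | zero => simp [annulus]
  | succ i => exact Set.sdiff_subset

theorem measurableSet_annulus (n : ℕ) (j : ℤ) (z : Fin n → ℤ) (i : ℕ) :
    MeasurableSet (annulus n j z i) := by
  cases i with
  | zero => exact (isClosed_cCube _ _ _ _).measurableSet
  | succ i =>
    exact (isClosed_cCube _ _ _ _).measurableSet.diff (isClosed_cCube _ _ _ _).measurableSet

/-- The annuli are contained in closed sets far away from the cube. -/
theorem exists_isClosed_annulus_subset {n : ℕ} (hn : 0 < n) (j : ℤ) (z : Fin n → ℤ) (i : ℕ) :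
    ∃ F : Set (Edom n), IsClosed F ∧ annulus n j z i ⊆ F ∧
      ((2 : ℝ) ^ i - 1) * 2 ^ j / 2 ≤ setDist (cCube n j z 1) F := by
  have hl : (0 : ℝ) < 2 ^ j := by positivity
  cases i with
  | zero =>
    refine ⟨Set.univ, isClosed_univ, Set.subset_univ _, ?_⟩
    simp only [pow_zero, sub_self, zero_mul, zero_div]
    refine Real.sInf_nonneg ?_
    rintro _ ⟨x, _, y, _, rfl⟩
    exact dist_nonneg
  | succ i =>
    refine ⟨{x | ∃ k, 2 ^ (i + 1) * (2 : ℝ) ^ j / 2 ≤ |x k - (2 : ℝ) ^ j * (z k + 1 / 2)|},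
      ?_, ?_, ?_⟩
    · rw [Set.ofPred_exists]
      exact isClosed_iUnion_of_finite fun k => isClosed_le (by fun_prop) (by fun_prop)
    · intro x hx
      by_contra hcon
      refine hx.2 fun k => ?_
      by_contra hk
      exact hcon ⟨k, (not_le.1 hk).le⟩
    · refine le_csInf ⟨_, WithLp.toLp 2 fun k => (2 : ℝ) ^ j * (z k + 1 / 2), fun k => ?_,
        WithLp.toLp 2 fun k => (2 : ℝ) ^ j * (z k + 1 / 2) + 2 ^ (i + 1) * (2 : ℝ) ^ j / 2,
        ⟨⟨0, hn⟩, ?_⟩, rfl⟩ ?_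
      · simp only [sub_self, abs_zero]
        positivity
      · simp only [add_sub_cancel_left]
        exact le_abs_self _
      · rintro _ ⟨x, hx, y, ⟨k, hk⟩, rfl⟩
        have h1 := hx k
        have h2 : |y k - x k| ≤ dist x y := by
          rw [dist_comm, dist_eq_norm]
          exact PiLp.norm_apply_le (y - x) k
        have h3 := abs_sub_le (y k) (x k) ((2 : ℝ) ^ j * (z k + 1 / 2))
        linarith

theorem enorm_Lp_two_sq {n m : ℕ} (f : HS n m) : ‖f‖ₑ ^ 2 = ∫⁻ x, ‖f x‖ₑ ^ 2 := by
  have h := eLpNorm_nnreal_pow_eq_lintegral (μ := volume) (f := (f : Edom n → Erng m))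
    (p := 2) two_ne_zero
  rw [Lp.enorm_def]
  simpa using h

theorem div_one_add_pow_le {N i : ℕ} {CN d l t : ℝ} (hCN : 0 < CN) (ht : 0 < t) (htl : t ≤ l)
    (hd : ((2 : ℝ) ^ i - 1) * l / 2 ≤ d) :
    CN / (1 + d / t) ^ N ≤ CN * 2 ^ N * ((2 ^ N)⁻¹) ^ i := by
  have h1i : (1 : ℝ) ≤ 2 ^ i := one_le_pow₀ one_le_two
  have h1 : (2 : ℝ) ^ i / 2 ≤ 1 + d / t := by
    have : ((2 : ℝ) ^ i - 1) / 2 ≤ d / t := by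
      rw [le_div_iff₀ ht]
      nlinarith
    linarith
  calc CN / (1 + d / t) ^ N ≤ CN / ((2 : ℝ) ^ i / 2) ^ N := by gcongr
    _ = _ := by
      rw [div_pow, inv_pow, ← pow_mul, ← pow_mul, mul_comm i N]
      field_simp

theorem tsum_ofReal_mul_half_pow {K : ℝ} (hK : 0 ≤ K) :
    ∑' i : ℕ, ENNReal.ofReal (K * (1 / 2) ^ i) = ENNReal.ofReal (K * 2) := by
  rw [← ENNReal.ofReal_tsum_of_nonneg (fun i => by positivity)
    (summable_geometric_two.mul_left K), tsum_mul_left, tsum_geometric_two]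

/-- **key estimate in the principal part approximation.** Let `Θ` be a
bounded operator on `L²(ℝⁿ,ℂᵐ)` with off-diagonal bounds of order `N > n+2` at scale `t`.
Then for every smooth compactly supported `g`,
`Σ_{Q∈Δ_t} ‖Σ_{i≥0} Θ(1_{C_i(Q)}(g − g_Q))‖²_{L²(Q)} ≤ C t² ‖∇g‖²_{L²}`,
where each inner series converges in `L²(Q)` and `C` depends only on `n, m, N, C_N`. -/
theorem principal_part_approximation_key_estimate
    (n m : ℕ) (hn : 0 < n) (hm : 0 < m) (N : ℕ) (hN : n + 2 < N) (CN : ℝ) (hCN : 0 < CN) :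
    ∃ C : ℝ, 0 < C ∧
    ∀ t : ℝ, 0 < t → ∀ Θ : HS n m →L[ℂ] HS n m,
    -- off-diagonal bounds of order `N` at scale `t`
    (∀ E F : Set (Edom n), IsClosed E → IsClosed F →
      ∀ u : HS n m, (∀ᵐ x ∂(volume : Measure (Edom n)), x ∉ F → u x = 0) →
      eLpNorm (E.indicator (Θ u : Edom n → Erng m)) 2 volume
        ≤ ENNReal.ofReal (CN / (1 + setDist E F / t) ^ N * ‖u‖)) →
    ∀ j : ℤ, (2 : ℝ) ^ (j - 1) < t → t ≤ (2 : ℝ) ^ j →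
    ∀ g : Edom n → Erng m, ContDiff ℝ (⊤ : ℕ∞) g → HasCompactSupport g →
    ∀ F G : (Fin n → ℤ) → ℕ → HS n m,
      (∀ (z : Fin n → ℤ) (i : ℕ), (F z i : Edom n → Erng m) =ᵐ[volume]
        (annulus n j z i).indicator fun y => g y - cubeAvg j z g) →
      (∀ (z : Fin n → ℤ) (i : ℕ), (G z i : Edom n → Erng m) =ᵐ[volume]
        (dyCube n j z).indicator (Θ (F z i) : Edom n → Erng m)) →
      ∃ G' : (Fin n → ℤ) → HS n m,
        (∀ z : Fin n → ℤ, HasSum (G z) (G' z)) ∧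
        ∑' z : Fin n → ℤ, ∫⁻ x in dyCube n j z, (‖G' z x‖₊ : ℝ≥0∞) ^ 2
          ≤ ENNReal.ofReal (C * t ^ 2) *
            ∑ i : Fin n, ∫⁻ x, (‖fderiv ℝ g x (EuclideanSpace.single i (1 : ℝ))‖₊ : ℝ≥0∞) ^ 2 := by
  refine ⟨CN * 2 ^ N * 2 * (CN * 2 ^ N * 2 ^ n * n * 2 ^ (n + 2) * 2) * 4, by positivity, ?_⟩
  intro t ht Θ hΘ j hjt htj g hg hc F G hF hG
  have hg1 : ContDiff ℝ 1 g := hg.of_le (by exact_mod_cast le_top)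
  have hl : (0 : ℝ) < 2 ^ j := by positivity
  have hlt : ((2 : ℝ) ^ j) ^ 2 ≤ 4 * t ^ 2 := by
    rw [zpow_sub_one₀ two_ne_zero] at hjt
    nlinarith
  set a : ℕ → ℝ≥0∞ := fun i => ENNReal.ofReal (CN * 2 ^ N * ((2 ^ N)⁻¹) ^ i) with ha
  have hFsq (z : Fin n → ℤ) (i : ℕ) :
      ‖F z i‖ₑ ^ 2 ≤ ∫⁻ x in cCube n j z (2 ^ (i + 1)), ‖g x - cubeAvg j z g‖ₑ ^ 2 := by
    calc ‖F z i‖ₑ ^ 2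
        = ∫⁻ x in annulus n j z i, ‖g x - cubeAvg j z g‖ₑ ^ 2 := by
          rw [enorm_Lp_two_sq, ← lintegral_indicator (measurableSet_annulus n j z i)]
          refine lintegral_congr_ae ?_
          filter_upwards [hF z i] with x hx
          rw [hx]
          by_cases h : x ∈ annulus n j z i <;> simp [h]
      _ ≤ _ := lintegral_mono_set (annulus_subset_cCube n j z i)
  have hGF (z : Fin n → ℤ) (i : ℕ) : ‖G z i‖ₑ ≤ a i * ‖F z i‖ₑ := by
    obtain ⟨S, hS, hsub, hdist⟩ := exists_isClosed_annulus_subset hn j z i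
    have hoff := hΘ (cCube n j z 1) S (isClosed_cCube n j z 1) hS (F z i) (by
      filter_upwards [hF z i] with x hx hxS
      rw [hx, Set.indicator_of_notMem fun h => hxS (hsub h)])
    rw [Lp.enorm_def, eLpNorm_congr_ae (hG z i)]
    calc _ ≤ eLpNorm ((cCube n j z 1).indicator (Θ (F z i) : Edom n → Erng m)) 2 volume :=
          eLpNorm_mono_enorm fun x => enorm_indicator_le_of_subset
            (dyCube_subset_cCube n j z le_rfl) _ x
      _ ≤ _ := hoff
      _ ≤ ENNReal.ofReal (CN * 2 ^ N * ((2 ^ N)⁻¹) ^ i * ‖F z i‖) := by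
          gcongr
          exact div_one_add_pow_le hCN ht htj hdist
      _ = a i * ‖F z i‖ₑ := by
          rw [ENNReal.ofReal_mul (by positivity), ofReal_norm]
  have hdecay (i : ℕ) : (((2 : ℝ) ^ N)⁻¹) ^ i * (2 ^ (n + 2)) ^ i ≤ (1 / 2) ^ i := by
    rw [← mul_pow]
    refine pow_le_pow_left₀ (by positivity) ?_ i
    rw [inv_mul_le_iff₀ (by positivity), ← div_eq_mul_one_div, le_div_iff₀ two_pos, ← pow_succ]
    exact pow_le_pow_right₀ one_le_two hN
  have hA : ∑' i, a i ≤ ENNReal.ofReal (CN * 2 ^ N * 2) := by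
    rw [← tsum_ofReal_mul_half_pow (by positivity)]
    refine ENNReal.tsum_le_tsum fun i => ENNReal.ofReal_le_ofReal ?_
    refine mul_le_mul_of_nonneg_left (le_trans ?_ (hdecay i)) (by positivity)
    exact le_mul_of_one_le_right (by positivity) (one_le_pow₀ (one_le_pow₀ one_le_two))
  have hterm (i : ℕ) : a i * ∑' z, ‖F z i‖ₑ ^ 2 ≤
      ENNReal.ofReal (CN * 2 ^ N * 2 ^ n * n * 2 ^ (n + 2) * ((2 : ℝ) ^ j) ^ 2 * (1 / 2) ^ i) *
        gradEnergy g := by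
    have hp := (ENNReal.tsum_le_tsum fun z => hFsq z i).trans
      (tsum_lintegral_sub_cubeAvg_sq_le hg1 hc j (one_le_pow₀ one_le_two))
    refine (mul_le_mul_right hp _).trans ?_
    rw [← mul_assoc, ha, ← ENNReal.ofReal_mul (by positivity)]
    gcongr ENNReal.ofReal ?_ * _
    calc _ = CN * 2 ^ N * 2 ^ n * n * 2 ^ (n + 2) * ((2 : ℝ) ^ j) ^ 2 *
          ((((2 : ℝ) ^ N)⁻¹) ^ i * (2 ^ (n + 2)) ^ i) := by
          rw [← pow_mul 2 (i + 1), ← pow_mul 2 (n + 2), add_one_mul, pow_add 2 (i * (n + 2)),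
            mul_comm i (n + 2)]
          ring
      _ ≤ _ := mul_le_mul_of_nonneg_left (hdecay i) (by positivity)
  have hmain : ∑' z, (∑' i, ‖G z i‖ₑ) ^ 2 ≤
      ENNReal.ofReal (CN * 2 ^ N * 2 * (CN * 2 ^ N * 2 ^ n * n * 2 ^ (n + 2) * 2) * 4 * t ^ 2) *
        gradEnergy g := by
    calc ∑' z, (∑' i, ‖G z i‖ₑ) ^ 2
        ≤ ∑' z, (∑' i, a i) * ∑' i, a i * ‖F z i‖ₑ ^ 2 := by
          refine ENNReal.tsum_le_tsum fun z => le_trans ?_ (sq_tsum_mul_le _ _)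
          exact pow_le_pow_left₀ zero_le (ENNReal.tsum_le_tsum (hGF z)) 2
      _ = (∑' i, a i) * ∑' i, a i * ∑' z, ‖F z i‖ₑ ^ 2 := by
          rw [ENNReal.tsum_mul_left, ENNReal.tsum_comm]
          simp_rw [ENNReal.tsum_mul_left]
      _ ≤ ENNReal.ofReal (CN * 2 ^ N * 2) *
          (ENNReal.ofReal (CN * 2 ^ N * 2 ^ n * n * 2 ^ (n + 2) * ((2 : ℝ) ^ j) ^ 2 * 2) *
            gradEnergy g) := by
          gcongr
          rw [← tsum_ofReal_mul_half_pow (by positivity), ← ENNReal.tsum_mul_right]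
          exact ENNReal.tsum_le_tsum hterm
      _ ≤ _ := by
          rw [← mul_assoc, ← ENNReal.ofReal_mul (by positivity)]
          gcongr ENNReal.ofReal ?_ * _
          calc _ = CN * 2 ^ N * 2 * (CN * 2 ^ N * 2 ^ n * n * 2 ^ (n + 2) * 2) *
                ((2 : ℝ) ^ j) ^ 2 := by ring
            _ ≤ CN * 2 ^ N * 2 * (CN * 2 ^ N * 2 ^ n * n * 2 ^ (n + 2) * 2) * (4 * t ^ 2) := by
                gcongr
            _ = _ := by ring
  have hfin (z : Fin n → ℤ) : ∑' i, ‖G z i‖ₑ ≠ ⊤ := by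
    have h := ((ENNReal.le_tsum z).trans hmain).trans_lt
      (ENNReal.mul_lt_top ENNReal.ofReal_lt_top (gradEnergy_ne_top hg1 hc).lt_top)
    intro htop
    simp [htop] at h
  have hsum (z : Fin n → ℤ) : Summable (G z) :=
    Summable.of_enorm (hfin z)
  refine ⟨fun z => ∑' i, G z i, fun z => (hsum z).hasSum, le_trans ?_ hmain⟩
  refine ENNReal.tsum_le_tsum fun z => ?_
  calc _ ≤ ∫⁻ x, ‖(∑' i, G z i : HS n m) x‖ₑ ^ 2 := setLIntegral_le_lintegral _ _
    _ = ‖∑' i, G z i‖ₑ ^ 2 := (enorm_Lp_two_sq _).symm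
    _ ≤ _ := pow_le_pow_left₀ zero_le enorm_tsum_le_tsum_enorm 2
end
end

section
/- Let H be a complex Hilbert space and let (Q_t)_{t>0} be a family of bounded linear operators on H with sup_{t>0} ‖Q_t‖ ≤ M and such that t ↦ Q_t f is continuous on (0,∞) for each f ∈ H. Assume the quadratic estimates ∫₀^∞ ‖Q_t f‖² dt/t ≤ C² ‖f‖² and ∫₀^∞ ‖Q_t^* g‖² dt/t ≤ C² ‖g‖² hold for all f, g ∈ H, where Q_t^* is the adjoint of Q_t. Then for all f, g ∈ H, ∫₀^∞ |⟨Q_t(Q_t(Q_t f)), g⟩| dt/t ≤ M C² ‖f‖ ‖g‖. (This is the key bound showing that the integral c∫₀^∞ (Q_t^B)³ f dt/t defining sgn(BD) gives a bounded operator.) -/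
open MeasureTheory
open scoped InnerProductSpace ENNReal

/-- If `(Q_t)_{t>0}` is a uniformly bounded, strongly continuous family of
operators on a complex Hilbert space satisfying quadratic estimates together with its adjoint
family, then `∫₀^∞ |⟨Q_t³ f, g⟩| dt/t ≤ M C² ‖f‖ ‖g‖`; this is the key bound showing that
`c ∫₀^∞ (Q_t^B)³ f dt/t` defines a bounded operator (`sgn(BD)`). -/
theorem triple_Qt_pairing_bound
    {H : Type*} [NormedAddCommGroup H] [InnerProductSpace ℂ H] [CompleteSpace H]
    (Q : ℝ → H →L[ℂ] H) (M C : ℝ)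
    (hM : ∀ t : ℝ, 0 < t → ‖Q t‖ ≤ M)
    (hcont : ∀ f : H, ContinuousOn (fun t : ℝ => Q t f) (Set.Ioi 0))
    (hQE : ∀ f : H, ∫⁻ t in Set.Ioi (0 : ℝ), ENNReal.ofReal (‖Q t f‖ ^ 2 / t)
      ≤ ENNReal.ofReal (C ^ 2 * ‖f‖ ^ 2))
    (hQEadj : ∀ g : H, ∫⁻ t in Set.Ioi (0 : ℝ),
        ENNReal.ofReal (‖ContinuousLinearMap.adjoint (Q t) g‖ ^ 2 / t)
      ≤ ENNReal.ofReal (C ^ 2 * ‖g‖ ^ 2))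
    (f g : H) :
    ∫⁻ t in Set.Ioi (0 : ℝ), ENNReal.ofReal (‖⟪Q t (Q t (Q t f)), g⟫_ℂ‖ / t)
      ≤ ENNReal.ofReal (M * C ^ 2 * ‖f‖ * ‖g‖) := by
  have hM0 : 0 ≤ M := (norm_nonneg _).trans (hM 1 one_pos)
  rcases eq_or_ne f 0 with rfl | hf
  · simp
  rcases eq_or_ne g 0 with rfl | hg
  · simp
  have hf' : 0 < ‖f‖ := norm_pos_iff.mpr hf
  have hg' : 0 < ‖g‖ := norm_pos_iff.mpr hg
  set a : ℝ := M * (‖g‖ / ‖f‖) / 2 with ha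
  set b : ℝ := M * (‖f‖ / ‖g‖) / 2 with hb
  have ha0 : 0 ≤ a := by positivity
  have hb0 : 0 ≤ b := by positivity
  have hmeas : AEMeasurable (fun t : ℝ => ENNReal.ofReal a * ENNReal.ofReal (‖Q t f‖ ^ 2 / t))
      (volume.restrict (Set.Ioi 0)) := by
    refine AEMeasurable.const_mul (AEMeasurable.ennreal_ofReal ?_) _
    refine ContinuousOn.aemeasurable ?_ measurableSet_Ioi
    exact ((hcont f).norm.pow 2).div continuousOn_id fun t ht => (Set.mem_Ioi.mp ht).ne'
  calc ∫⁻ t in Set.Ioi (0 : ℝ), ENNReal.ofReal (‖⟪Q t (Q t (Q t f)), g⟫_ℂ‖ / t)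
      ≤ ∫⁻ t in Set.Ioi (0 : ℝ), (ENNReal.ofReal a * ENNReal.ofReal (‖Q t f‖ ^ 2 / t) +
          ENNReal.ofReal b *
            ENNReal.ofReal (‖ContinuousLinearMap.adjoint (Q t) g‖ ^ 2 / t)) := by
        refine setLIntegral_mono' measurableSet_Ioi fun t ht => ?_
        have ht0 : 0 < t := ht
        rw [← ENNReal.ofReal_mul ha0, ← ENNReal.ofReal_mul hb0,
          ← ENNReal.ofReal_add (by positivity) (by positivity)]
        refine ENNReal.ofReal_le_ofReal ?_
        rw [← mul_div_assoc, ← mul_div_assoc, ← add_div]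
        refine div_le_div_of_nonneg_right ?_ ht0.le
        set x := ‖Q t f‖
        set y := ‖ContinuousLinearMap.adjoint (Q t) g‖
        calc ‖⟪Q t (Q t (Q t f)), g⟫_ℂ‖
            = ‖⟪Q t (Q t f), ContinuousLinearMap.adjoint (Q t) g⟫_ℂ‖ := by
              rw [ContinuousLinearMap.adjoint_inner_right]
          _ ≤ ‖Q t (Q t f)‖ * y := norm_inner_le_norm _ _
          _ ≤ M * x * y := by
              gcongr
              exact (Q t).le_of_opNorm_le (hM t ht0) _
          _ ≤ a * x ^ 2 + b * y ^ 2 := by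
              have key : a * x ^ 2 + b * y ^ 2 - M * x * y =
                  M * (‖g‖ * x - ‖f‖ * y) ^ 2 / (2 * ‖f‖ * ‖g‖) := by
                rw [ha, hb]
                field_simp
                ring
              have : 0 ≤ M * (‖g‖ * x - ‖f‖ * y) ^ 2 / (2 * ‖f‖ * ‖g‖) := by positivity
              linarith
    _ = ENNReal.ofReal a * (∫⁻ t in Set.Ioi (0 : ℝ), ENNReal.ofReal (‖Q t f‖ ^ 2 / t)) +
          ENNReal.ofReal b * ∫⁻ t in Set.Ioi (0 : ℝ),
            ENNReal.ofReal (‖ContinuousLinearMap.adjoint (Q t) g‖ ^ 2 / t) := by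
        rw [lintegral_add_left' hmeas, lintegral_const_mul' _ _ ENNReal.ofReal_ne_top,
          lintegral_const_mul' _ _ ENNReal.ofReal_ne_top]
    _ ≤ ENNReal.ofReal a * ENNReal.ofReal (C ^ 2 * ‖f‖ ^ 2) +
          ENNReal.ofReal b * ENNReal.ofReal (C ^ 2 * ‖g‖ ^ 2) := by
        gcongr
        · exact hQE f
        · exact hQEadj g
    _ = ENNReal.ofReal (M * C ^ 2 * ‖f‖ * ‖g‖) := by
        rw [← ENNReal.ofReal_mul ha0, ← ENNReal.ofReal_mul hb0,
          ← ENNReal.ofReal_add (by positivity) (by positivity), ha, hb]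
        congr 1
        field_simp
        ring
end

section
/- Let H₀, H₁ be complex Hilbert spaces, H = H₀ × H₁, let V₁ ⊆ H₁ be a closed subspace and V = H₀ × V₁. Let A : H → H be a bounded linear operator, written in block form A(u₀,u₁) = (a u₀ + b u₁, c u₀ + d u₁), and suppose there is κ > 0 with Re⟨Av, v⟩ ≥ κ‖v‖² for all v ∈ V. Then: (i) Re⟨a u₀, u₀⟩ ≥ κ‖u₀‖² for all u₀ ∈ H₀, and a is invertible with bounded inverse; (ii) the operator T(u₀,u₁) = (a u₀ + b u₁, u₁) is invertible on H and maps V bijectively onto V; (iii) the operator Â := [[1, 0],[c, d]] ∘ T^{-1}, i.e. Â(v₀,v₁) = (w₀, c w₀ + d w₁) where (w₀,w₁) = T^{-1}(v₀,v₁), is bounded and satisfies Re⟨Â v, v⟩ ≥ (κ/‖T‖²)‖v‖² for all v ∈ V; in particular Â is strictly accretive on V. -/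
open scoped InnerProductSpace

/-- A strictly accretive bounded operator on a Hilbert space is invertible. -/
theorem isUnit_of_re_inner_ge {E : Type*} [NormedAddCommGroup E] [InnerProductSpace ℂ E]
    [CompleteSpace E] (f : E →L[ℂ] E) {κ : ℝ} (hκ : 0 < κ)
    (h : ∀ x, κ * ‖x‖ ^ 2 ≤ (⟪f x, x⟫_ℂ).re) : IsUnit f :=
  f.isUnit_of_forall_le_norm_inner_map (c := ⟨κ, hκ.le⟩) hκ fun x ↦ by
    rw [mul_comm]
    exact (h x).trans (Complex.re_le_norm _)

/-- Let `H = H₀ ×₂ H₁` (Hilbert product), `V = H₀ × V₁` with `V₁` closed,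
and let `A` be bounded with block form `A(u₀,u₁) = (au₀+bu₁, cu₀+du₁)` and strictly
accretive on `V` with constant `κ`. Then (i) `a` is strictly accretive and invertible,
(ii) `T(u₀,u₁) = (au₀+bu₁, u₁)` is invertible on `H` and maps `V` bijectively onto `V`,
(iii) `Â = [[1,0],[c,d]] ∘ T⁻¹` is bounded and satisfies
`Re⟪Âv, v⟫ ≥ (κ/‖T‖²)‖v‖²` for all `v ∈ V`. -/
theorem hat_transform_accretive
    {H₀ H₁ : Type*} [NormedAddCommGroup H₀] [InnerProductSpace ℂ H₀] [CompleteSpace H₀]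
    [NormedAddCommGroup H₁] [InnerProductSpace ℂ H₁] [CompleteSpace H₁]
    (V₁ : Submodule ℂ H₁) (hV₁ : IsClosed (V₁ : Set H₁))
    (V : Set (WithLp 2 (H₀ × H₁)))
    (hV : V = {v : WithLp 2 (H₀ × H₁) | (WithLp.equiv 2 (H₀ × H₁) v).2 ∈ V₁})
    (A : WithLp 2 (H₀ × H₁) →L[ℂ] WithLp 2 (H₀ × H₁))
    (a : H₀ →L[ℂ] H₀) (b : H₁ →L[ℂ] H₀) (c : H₀ →L[ℂ] H₁) (d : H₁ →L[ℂ] H₁)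
    (hA : ∀ u : WithLp 2 (H₀ × H₁),
      WithLp.equiv 2 (H₀ × H₁) (A u) =
        (a (WithLp.equiv 2 (H₀ × H₁) u).1 + b (WithLp.equiv 2 (H₀ × H₁) u).2,
         c (WithLp.equiv 2 (H₀ × H₁) u).1 + d (WithLp.equiv 2 (H₀ × H₁) u).2))
    (κ : ℝ) (hκ : 0 < κ)
    (hacc : ∀ v ∈ V, κ * ‖v‖ ^ 2 ≤ (⟪A v, v⟫_ℂ).re) :
    -- (i) `a` is strictly accretive and invertible with bounded inverse
    (∀ u₀ : H₀, κ * ‖u₀‖ ^ 2 ≤ (⟪a u₀, u₀⟫_ℂ).re) ∧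
    ∃ ainv : H₀ →L[ℂ] H₀, a.comp ainv = ContinuousLinearMap.id ℂ H₀ ∧
      ainv.comp a = ContinuousLinearMap.id ℂ H₀ ∧
    -- (ii) `T` is invertible on `H` and maps `V` bijectively onto `V`
    ∃ T Tinv : WithLp 2 (H₀ × H₁) →L[ℂ] WithLp 2 (H₀ × H₁),
      (∀ u : WithLp 2 (H₀ × H₁),
        WithLp.equiv 2 (H₀ × H₁) (T u) =
          (a (WithLp.equiv 2 (H₀ × H₁) u).1 + b (WithLp.equiv 2 (H₀ × H₁) u).2,
           (WithLp.equiv 2 (H₀ × H₁) u).2)) ∧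
      T.comp Tinv = ContinuousLinearMap.id ℂ _ ∧
      Tinv.comp T = ContinuousLinearMap.id ℂ _ ∧
      Set.BijOn T V V ∧
    -- (iii) `Â = [[1,0],[c,d]] ∘ T⁻¹` is strictly accretive on `V`
    ∃ Ahat : WithLp 2 (H₀ × H₁) →L[ℂ] WithLp 2 (H₀ × H₁),
      (∀ v : WithLp 2 (H₀ × H₁),
        WithLp.equiv 2 (H₀ × H₁) (Ahat v) =
          ((WithLp.equiv 2 (H₀ × H₁) (Tinv v)).1,
           c (WithLp.equiv 2 (H₀ × H₁) (Tinv v)).1 +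
             d (WithLp.equiv 2 (H₀ × H₁) (Tinv v)).2)) ∧
      ∀ v ∈ V, κ / ‖T‖ ^ 2 * ‖v‖ ^ 2 ≤ (⟪Ahat v, v⟫_ℂ).re := by
  subst hV
  replace hA : ∀ u, A u = WithLp.toLp 2 (a u.fst + b u.snd, c u.fst + d u.snd) :=
    fun u ↦ (WithLp.equiv 2 (H₀ × H₁)).injective (hA u)
  have ha : ∀ u₀ : H₀, κ * ‖u₀‖ ^ 2 ≤ (⟪a u₀, u₀⟫_ℂ).re := fun u₀ ↦ by
    simpa [hA, WithLp.prod_norm_sq_eq_of_L2] using hacc (WithLp.toLp 2 (u₀, 0)) V₁.zero_mem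
  refine ⟨ha, ?_⟩
  obtain ⟨a, rfl⟩ : IsUnit a := isUnit_of_re_inner_ge a hκ ha
  refine ⟨↑a⁻¹, a.mul_inv, a.inv_mul, ?_⟩
  have ha_inv (x : H₀) : (a : H₀ →L[ℂ] H₀) ((↑a⁻¹ : H₀ →L[ℂ] H₀) x) = x :=
    DFunLike.congr_fun a.mul_inv x
  have hinv_a (x : H₀) : (↑a⁻¹ : H₀ →L[ℂ] H₀) ((a : H₀ →L[ℂ] H₀) x) = x :=
    DFunLike.congr_fun a.inv_mul x
  let e := WithLp.prodContinuousLinearEquiv 2 ℂ H₀ H₁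
  let p := ContinuousLinearMap.fst ℂ H₀ H₁
  let q := ContinuousLinearMap.snd ℂ H₀ H₁
  let T : WithLp 2 (H₀ × H₁) →L[ℂ] WithLp 2 (H₀ × H₁) :=
    e.symm ∘L (((a : H₀ →L[ℂ] H₀) ∘L p + b ∘L q).prod q) ∘L e
  let S : WithLp 2 (H₀ × H₁) →L[ℂ] WithLp 2 (H₀ × H₁) :=
    e.symm ∘L (((↑a⁻¹ : H₀ →L[ℂ] H₀) ∘L (p - b ∘L q)).prod q) ∘L e
  have hT (u) : T u = WithLp.toLp 2 ((a : H₀ →L[ℂ] H₀) u.fst + b u.snd, u.snd) := rfl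
  have hS (u) : S u = WithLp.toLp 2 ((↑a⁻¹ : H₀ →L[ℂ] H₀) (u.fst - b u.snd), u.snd) := rfl
  have hTS (u) : T (S u) = u := by
    simp only [hT, hS, WithLp.toLp_fst, WithLp.toLp_snd, ha_inv, sub_add_cancel]
    rfl
  have hST (u) : S (T u) = u := by
    simp only [hT, hS, WithLp.toLp_fst, WithLp.toLp_snd, hinv_a, add_sub_cancel_right]
    rfl
  refine ⟨T, S, fun _ ↦ rfl, ContinuousLinearMap.ext hTS, ContinuousLinearMap.ext hST,
    Set.InvOn.bijOn ⟨fun u _ ↦ hST u, fun u _ ↦ hTS u⟩ (fun _ hu ↦ hu) (fun _ hu ↦ hu),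
    e.symm ∘L (p.prod (c ∘L p + d ∘L q)) ∘L e ∘L S, fun _ ↦ rfl, fun v hv ↦ ?_⟩
  obtain ⟨u, rfl⟩ : ∃ u, T u = v := ⟨S v, hTS v⟩
  have hinner : (⟪A u, u⟫_ℂ).re =
      (⟪(e.symm ∘L (p.prod (c ∘L p + d ∘L q)) ∘L e ∘L S) (T u), T u⟫_ℂ).re := by
    change _ = (⟪(WithLp.toLp 2 ((S (T u)).fst, c (S (T u)).fst + d (S (T u)).snd) :
      WithLp 2 (H₀ × H₁)), T u⟫_ℂ).re
    rw [hST, hT, hA]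
    simp only [WithLp.prod_inner_apply, Complex.add_re]
    congr 1
    exact inner_re_symm (𝕜 := ℂ) _ _
  rw [← hinner]
  refine le_trans ?_ (hacc u hv)
  calc κ / ‖T‖ ^ 2 * ‖T u‖ ^ 2 ≤ κ / ‖T‖ ^ 2 * (‖T‖ * ‖u‖) ^ 2 := by
        gcongr
        exact T.le_opNorm u
    _ = κ * ‖u‖ ^ 2 * (‖T‖ ^ 2 / ‖T‖ ^ 2) := by ring
    _ ≤ κ * ‖u‖ ^ 2 := mul_le_of_le_one_right (by positivity) (div_self_le_one _)
end

section
/- Let H be a complex Hilbert space and let R₁, N₁, N₂, R₂ be closed subspaces of H such that R₁ ∩ N₁ = {0}, R₁ + N₁ = H, N₂ ∩ R₂ = {0}, N₂ + R₂ = H, and moreover R₁ ⊆ N₂ and R₂ ⊆ N₁. Then every u ∈ H has a unique decomposition u = u₀ + u₁ + u₂ with u₀ ∈ N₁ ∩ N₂, u₁ ∈ R₁ and u₂ ∈ R₂; that is, H = (N₁ ∩ N₂) ⊕ R₁ ⊕ R₂ as a topological direct sum. -/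
/-- If `R₁, N₁, N₂, R₂` are closed subspaces of a complex Hilbert space
with `R₁ ⊕ N₁ = H`, `N₂ ⊕ R₂ = H` (topological direct sums), `R₁ ⊆ N₂` and `R₂ ⊆ N₁`, then
every `u ∈ H` decomposes uniquely as `u = u₀ + u₁ + u₂` with `u₀ ∈ N₁ ∩ N₂`, `u₁ ∈ R₁`,
`u₂ ∈ R₂`; that is, `H = (N₁ ∩ N₂) ⊕ R₁ ⊕ R₂`. -/
theorem triple_splitting_of_intertwined_splittings
    {H : Type*} [NormedAddCommGroup H] [InnerProductSpace ℂ H] [CompleteSpace H]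
    (R₁ N₁ N₂ R₂ : Submodule ℂ H)
    (hR₁ : IsClosed (R₁ : Set H)) (hN₁ : IsClosed (N₁ : Set H))
    (hN₂ : IsClosed (N₂ : Set H)) (hR₂ : IsClosed (R₂ : Set H))
    (h₁ : R₁ ⊓ N₁ = ⊥) (h₂ : R₁ ⊔ N₁ = ⊤)
    (h₃ : N₂ ⊓ R₂ = ⊥) (h₄ : N₂ ⊔ R₂ = ⊤)
    (h₅ : R₁ ≤ N₂) (h₆ : R₂ ≤ N₁) (u : H) :
    ∃! w : H × H × H, w.1 ∈ N₁ ⊓ N₂ ∧ w.2.1 ∈ R₁ ∧ w.2.2 ∈ R₂ ∧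
      u = w.1 + w.2.1 + w.2.2 := by
  obtain ⟨r₁, hr₁, n₁, hn₁, rfl⟩ := Submodule.mem_sup.1 (h₂ ▸ Submodule.mem_top : u ∈ R₁ ⊔ N₁)
  obtain ⟨n₂, hn₂, r₂, hr₂, rfl⟩ := Submodule.mem_sup.1 (h₄ ▸ Submodule.mem_top : n₁ ∈ N₂ ⊔ R₂)
  have hn₂' : n₂ ∈ N₁ := by simpa using N₁.sub_mem hn₁ (h₆ hr₂)
  refine ⟨(n₂, r₁, r₂), ⟨⟨hn₂', hn₂⟩, hr₁, hr₂, by abel⟩, ?_⟩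
  rintro ⟨v₀, v₁, v₂⟩ ⟨⟨hv₀, hv₀'⟩, hv₁, hv₂, hv⟩
  dsimp only at hv₀ hv₀' hv₁ hv₂ hv
  have e₂ : v₂ - r₂ = 0 := by
    rw [← Submodule.mem_bot ℂ, ← h₃]
    refine ⟨?_, R₂.sub_mem hv₂ hr₂⟩
    have e : v₂ - r₂ = (n₂ + r₁) - (v₀ + v₁) := by
      rw [sub_eq_sub_iff_add_eq_add, add_comm v₂, ← hv]
      abel
    exact e ▸ N₂.sub_mem (N₂.add_mem hn₂ (h₅ hr₁)) (N₂.add_mem hv₀' (h₅ hv₁))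
  obtain rfl := sub_eq_zero.1 e₂
  rw [← add_assoc, add_left_inj] at hv
  have e₁ : v₁ - r₁ = 0 := by
    rw [← Submodule.mem_bot ℂ, ← h₁]
    refine ⟨R₁.sub_mem hv₁ hr₁, ?_⟩
    have e : v₁ - r₁ = n₂ - v₀ := by
      rw [sub_eq_sub_iff_add_eq_add, add_comm v₁, ← hv, add_comm]
    exact e ▸ N₁.sub_mem hn₂' hv₀
  obtain rfl := sub_eq_zero.1 e₁
  rw [add_comm, add_left_inj] at hv
  rw [hv]
end

section
/- Define the operator DB with domain 𝖣(DB) = {u ∈ H : Bu ∈ 𝖣(D)} by (DB)u = D(Bu). Then: (a) the range of DB equals the range of D, i.e. {D(Bu) : u ∈ 𝖣(DB)} = {Dv : v ∈ 𝖣(D)}; (b) the null space N(DB) = {u ∈ 𝖣(DB) : D(Bu) = 0} equals the orthogonal complement of {B^*(Dv) : v ∈ 𝖣(D)}, where B^* is the adjoint of B; (c) the closed subspace closure(R(D)) and N(DB) satisfy closure(R(D)) ∩ N(DB) = {0} and closure(R(D)) + N(DB) = H, i.e. H splits topologically as the direct sum of the closure of the range of DB and the null space of DB. -/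
open scoped InnerProductSpace

/-- A bounded operator that is strictly accretive on a closed subspace `K` takes every value
modulo `Kᗮ` on `K`. -/
theorem ContinuousLinearMap.exists_mem_apply_sub_mem_orthogonal_of_accretiveOn
    {H : Type*} [NormedAddCommGroup H] [InnerProductSpace ℂ H]
    (K : Submodule ℂ H) [CompleteSpace K] (B : H →L[ℂ] H) {δ : ℝ} (hδ : 0 < δ)
    (hacc : ∀ u ∈ K, δ * ‖u‖ ^ 2 ≤ (⟪B u, u⟫_ℂ).re) (h : H) :
    ∃ k ∈ K, B k - h ∈ Kᗮ := by
  let T : K →L[ℂ] K := K.orthogonalProjectionOnto.comp (B.comp K.subtypeL)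
  have hT (u : K) : δ * ‖u‖ ^ 2 ≤ (⟪T u, u⟫_ℂ).re := by
    have : ⟪T u, u⟫_ℂ = ⟪B u, (u : H)⟫_ℂ := by
      simp [T]
    rw [this]
    exact hacc u u.2
  have hbound (u : K) : δ * ‖u‖ ≤ ‖T u‖ := by
    rcases (norm_nonneg u).eq_or_lt with h0 | h0
    · simp [← h0]
    · have h1 : (⟪T u, u⟫_ℂ).re ≤ ‖T u‖ * ‖u‖ := re_inner_le_norm (𝕜 := ℂ) (T u) u
      have h2 := hT u
      nlinarith
  have hanti : AntilipschitzWith (Real.toNNReal δ⁻¹) T := by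
    refine T.antilipschitz_of_bound fun u => ?_
    rw [Real.coe_toNNReal _ (inv_nonneg.2 hδ.le), inv_mul_eq_div, le_div_iff₀ hδ, mul_comm]
    exact hbound u
  have hclosed : IsClosed (T.range : Set K) := by
    rw [LinearMap.coe_range]
    exact hanti.isClosed_range T.uniformContinuous
  have : CompleteSpace T.range := hclosed.completeSpace_coe
  have hrange : T.range = ⊤ := by
    rw [← Submodule.orthogonal_eq_bot_iff, Submodule.eq_bot_iff]
    intro y hy
    have h1 : ⟪T y, y⟫_ℂ = 0 := hy (T y) ⟨y, rfl⟩
    have h2 := hT y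
    rw [h1, Complex.zero_re] at h2
    have h3 : ‖y‖ ^ 2 ≤ 0 := nonpos_of_mul_nonpos_right h2 hδ
    simpa using le_antisymm h3 (sq_nonneg _)
  obtain ⟨k, hk⟩ : K.orthogonalProjectionOnto h ∈ T.range := hrange ▸ Submodule.mem_top
  refine ⟨k, k.2, ?_⟩
  rw [← Submodule.orthogonalProjectionOnto_eq_zero_iff, map_sub, sub_eq_zero]
  exact hk

/-- Strict accretivity on a subspace extends to its closure. -/
theorem ContinuousLinearMap.accretiveOn_topologicalClosure
    {H : Type*} [NormedAddCommGroup H] [InnerProductSpace ℂ H]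
    (R : Submodule ℂ H) (B : H →L[ℂ] H) {δ : ℝ}
    (hacc : ∀ u ∈ R, δ * ‖u‖ ^ 2 ≤ (⟪B u, u⟫_ℂ).re) :
    ∀ u ∈ R.topologicalClosure, δ * ‖u‖ ^ 2 ≤ (⟪B u, u⟫_ℂ).re := by
  have hclosed : IsClosed {u : H | δ * ‖u‖ ^ 2 ≤ (⟪B u, u⟫_ℂ).re} :=
    isClosed_le (by fun_prop)
      (Complex.continuous_re.comp (B.continuous.inner continuous_id))
  exact fun u hu => closure_minimal hacc hclosed hu

/-- The null space of a self-adjoint operator is the orthogonal complement of its range. -/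
theorem LinearMap.map_subtype_ker_eq_orthogonal_range
    {H : Type*} [NormedAddCommGroup H] [InnerProductSpace ℂ H]
    (dom : Submodule ℂ H) (D : dom →ₗ[ℂ] H)
    (hsym : ∀ u v : dom, ⟪D u, (v : H)⟫_ℂ = ⟪(u : H), D v⟫_ℂ)
    (hsa : ∀ v w : H, (∀ u : dom, ⟪D u, v⟫_ℂ = ⟪(u : H), w⟫_ℂ) →
      ∃ hv : v ∈ dom, D ⟨v, hv⟩ = w) :
    (LinearMap.ker D).map dom.subtype = (LinearMap.range D)ᗮ := by
  ext w
  constructor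
  · rintro ⟨v, hv, rfl⟩ _ ⟨u, rfl⟩
    rw [Submodule.subtype_apply, hsym, LinearMap.mem_ker.1 hv, inner_zero_right]
  · intro hw
    obtain ⟨hv, h0⟩ := hsa w 0 fun u => by
      rw [inner_zero_right]
      exact hw _ ⟨u, rfl⟩
    exact ⟨⟨w, hv⟩, h0, rfl⟩

/-- For a densely defined self-adjoint `D` and a bounded `B` strictly
accretive on the range of `D`, the operator `DB` (with domain `{u : Bu ∈ 𝖣(D)}`,
`u ↦ D(Bu)`) satisfies: (a) `R(DB) = R(D)`; (b) `N(DB) = R(B*D)ᗮ`; and (c) `H` splits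
topologically as the direct sum of the closure of the range of `DB` and the null space
of `DB`. -/
theorem DB_range_null_and_splitting
    {H : Type*} [NormedAddCommGroup H] [InnerProductSpace ℂ H] [CompleteSpace H]
    (dom : Submodule ℂ H) (D : dom →ₗ[ℂ] H)
    (hdense : Dense (dom : Set H))
    (hsym : ∀ u v : dom, ⟪D u, (v : H)⟫_ℂ = ⟪(u : H), D v⟫_ℂ)
    (hsa : ∀ v w : H, (∀ u : dom, ⟪D u, v⟫_ℂ = ⟪(u : H), w⟫_ℂ) →
      ∃ hv : v ∈ dom, D ⟨v, hv⟩ = w)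
    (B : H →L[ℂ] H) (δ : ℝ) (hδ : 0 < δ)
    (hacc : ∀ u : dom, δ * ‖D u‖ ^ 2 ≤ (⟪B (D u), D u⟫_ℂ).re) :
    -- (a) the range of `DB` equals the range of `D`
    ({v : H | ∃ (u : H) (h : B u ∈ dom), D ⟨B u, h⟩ = v} = (LinearMap.range D : Set H)) ∧
    -- (b) the null space of `DB` is the orthogonal complement of the range of `B* D`
    (Submodule.comap (B : H →ₗ[ℂ] H) ((LinearMap.ker D).map dom.subtype) =
      (LinearMap.range (((ContinuousLinearMap.adjoint B : H →L[ℂ] H) :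
        H →ₗ[ℂ] H).comp D))ᗮ) ∧
    -- (c) topological splitting `H = closure R(DB) ⊕ N(DB)`
    ((LinearMap.range D).topologicalClosure ⊓
        Submodule.comap (B : H →ₗ[ℂ] H) ((LinearMap.ker D).map dom.subtype) = ⊥) ∧
    ((LinearMap.range D).topologicalClosure ⊔
        Submodule.comap (B : H →ₗ[ℂ] H) ((LinearMap.ker D).map dom.subtype) = ⊤) := by
  have hker := LinearMap.map_subtype_ker_eq_orthogonal_range dom D hsym hsa
  have haccK := B.accretiveOn_topologicalClosure (LinearMap.range D)
    (by rintro _ ⟨u, rfl⟩; exact hacc u)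
  have hsurj (h : H) : ∃ k ∈ (LinearMap.range D).topologicalClosure,
      B k - h ∈ (LinearMap.range D)ᗮ := by
    rw [← Submodule.orthogonal_closure]
    exact B.exists_mem_apply_sub_mem_orthogonal_of_accretiveOn _ hδ haccK h
  refine ⟨?_, ?_, ?_, ?_⟩
  · ext v
    constructor
    · rintro ⟨u, h, rfl⟩
      exact ⟨_, rfl⟩
    · rintro ⟨w, rfl⟩
      obtain ⟨k, -, hk⟩ := hsurj w
      rw [← hker] at hk
      obtain ⟨z, hz, hzk⟩ := hk
      have hBk : B k = ((z + w : dom) : H) := by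
        rw [Submodule.coe_add]
        exact eq_add_of_sub_eq hzk.symm
      have hmem : B k ∈ dom := hBk ▸ (z + w).2
      refine ⟨k, hmem, ?_⟩
      rw [show (⟨B k, hmem⟩ : dom) = z + w from Subtype.ext hBk, map_add,
        LinearMap.mem_ker.1 hz, zero_add]
  · rw [hker]
    ext u
    simp only [Submodule.mem_comap, Submodule.mem_orthogonal, LinearMap.mem_range,
      forall_exists_index, forall_apply_eq_imp_iff, LinearMap.comp_apply,
      ContinuousLinearMap.coe_coe, ContinuousLinearMap.adjoint_inner_left]
  · rw [hker, Submodule.eq_bot_iff]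
    rintro u ⟨huK, hu⟩
    have hu' : B u ∈ (LinearMap.range D).topologicalClosureᗮ := by
      rw [Submodule.orthogonal_closure]
      exact hu
    have h2 := haccK u huK
    rw [Submodule.inner_left_of_mem_orthogonal huK hu', Complex.zero_re] at h2
    have h3 : ‖u‖ ^ 2 ≤ 0 := nonpos_of_mul_nonpos_right h2 hδ
    simpa using le_antisymm h3 (sq_nonneg _)
  · rw [hker, Submodule.eq_top_iff']
    intro u
    obtain ⟨k, hkK, hk⟩ := hsurj (B u)
    refine Submodule.mem_sup.2 ⟨k, hkK, u - k, ?_, add_sub_cancel k u⟩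
    rw [← neg_mem_iff] at hk
    simpa using hk
end
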